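/- arXiv:2305.07723 — 2 statements merged into one kernel-verified Lean document; each statement's English description precedes it below -/
import Mathlib

section
/- Let X = (X₀, X₁, …) be a sequence of S-valued random variables and let ξ = (ξ₀, ξ₁, …) be a product disintegration of X. Then for every continuous function f : S → ℝ, with probability one, limₙ→∞ (1/n) ∑_{i=0}^{n-1} ( f(Xᵢ) − ξᵢ(f) ) = 0, where ξᵢ(f) denotes the random variable ω ↦ ∫_S f dξᵢ(ω). -/
open MeasureTheory ProbabilityTheory Filter

noncomputable section

/-- The σ-algebra generated by a sequence of random (probability) measures. -/
def sigmaGen {Ω S : Type*} [MeasurableSpace S] (ξ : ℕ → Ω → Measure S) :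
    MeasurableSpace Ω :=
  ⨆ n, MeasurableSpace.comap (ξ n) inferInstance

/-- `ξ` is a product disintegration of `X`: each `ξ n` is a random probability measure on `S`,
each `X n` is a random variable, and for every `n` and Borel sets `A 0, …, A n`, almost surely
`𝔼[𝟙{X₀∈A₀} ⋯ 𝟙{Xₙ∈Aₙ} | σ(ξ)] = ξ₀(A₀) ⋯ ξₙ(Aₙ)`. -/
def IsProductDisintegration {Ω S : Type*} [MeasurableSpace Ω] [MeasurableSpace S]
    (P : Measure Ω) (X : ℕ → Ω → S) (ξ : ℕ → Ω → Measure S) : Prop :=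
  (∀ n, Measurable (X n)) ∧ (∀ n, Measurable (ξ n)) ∧
    (∀ n ω, IsProbabilityMeasure (ξ n ω)) ∧
    ∀ (n : ℕ) (A : Fin (n + 1) → Set S), (∀ i, MeasurableSet (A i)) →
      (P[(fun ω => ∏ i : Fin (n + 1), (A i).indicator (fun _ => (1 : ℝ)) (X i ω)) | sigmaGen ξ])
        =ᵐ[P] fun ω => ∏ i : Fin (n + 1), (ξ i ω (A i)).toReal

/-- Two sums over initial segments differ by at most the number of extra terms when the terms are
bounded by `1`, so the Cesàro averages converge as soon as they do along squares. -/
lemma tendsto_average_of_tendsto_average_sq {a : ℕ → ℝ} (ha : ∀ i, |a i| ≤ 1)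
    (h : Tendsto (fun k : ℕ => (1 / ((k ^ 2 : ℕ) : ℝ)) * ∑ i ∈ Finset.range (k ^ 2), a i)
      atTop (nhds 0)) :
    Tendsto (fun n : ℕ => (1 / (n : ℝ)) * ∑ i ∈ Finset.range n, a i) atTop (nhds 0) := by
  have hsqrt : Tendsto Nat.sqrt atTop atTop :=
    tendsto_atTop_atTop.2 fun b => ⟨b * b, fun n hn => Nat.le_sqrt.2 hn⟩
  have hbound : Tendsto (fun k : ℕ =>
      |(1 / ((k ^ 2 : ℕ) : ℝ)) * ∑ i ∈ Finset.range (k ^ 2), a i| + 2 * (1 / (k : ℝ)))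
      atTop (nhds 0) := by
    simpa using h.abs.add (tendsto_one_div_atTop_nhds_zero_nat (𝕜 := ℝ) |>.const_mul 2)
  refine squeeze_zero_norm' ?_ (hbound.comp hsqrt)
  filter_upwards [eventually_ge_atTop 1] with n hn
  simp only [Function.comp, Real.norm_eq_abs]
  set k := Nat.sqrt n with hk
  have hk1 : 1 ≤ k := Nat.le_sqrt.2 (by simpa using hn)
  have hkn : k ^ 2 ≤ n := Nat.sqrt_le' n
  have hnk : n ≤ k ^ 2 + 2 * k := by
    have := Nat.sqrt_le_add n
    rw [← hk] at this
    nlinarith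
  have hsplit := Finset.sum_range_add_sum_Ico a hkn
  have hIco : |∑ i ∈ Finset.Ico (k ^ 2) n, a i| ≤ 2 * k := by
    calc |∑ i ∈ Finset.Ico (k ^ 2) n, a i| ≤ ∑ i ∈ Finset.Ico (k ^ 2) n, |a i| :=
          Finset.abs_sum_le_sum_abs _ _
      _ ≤ ∑ i ∈ Finset.Ico (k ^ 2) n, 1 := Finset.sum_le_sum fun i _ => ha i
      _ = ((n - k ^ 2 : ℕ) : ℝ) := by simp
      _ ≤ ((2 * k : ℕ) : ℝ) := by
          have : n - k ^ 2 ≤ 2 * k := by omega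
          exact_mod_cast this
      _ = 2 * k := by push_cast; ring
  have hk0 : (0 : ℝ) < k := by exact_mod_cast hk1
  have hkn' : ((k ^ 2 : ℕ) : ℝ) ≤ n := by exact_mod_cast hkn
  have hk2 : (0 : ℝ) < ((k ^ 2 : ℕ) : ℝ) := by positivity
  rw [← hsplit, abs_mul, abs_mul, abs_of_pos (show (0 : ℝ) < 1 / n by positivity),
    abs_of_pos (show (0 : ℝ) < 1 / ((k ^ 2 : ℕ) : ℝ) by positivity)]
  calc 1 / (n : ℝ) * |∑ i ∈ Finset.range (k ^ 2), a i + ∑ i ∈ Finset.Ico (k ^ 2) n, a i|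
      ≤ 1 / ((k ^ 2 : ℕ) : ℝ) * (|∑ i ∈ Finset.range (k ^ 2), a i| + 2 * k) := by
        gcongr
        exact (abs_add_le _ _).trans (by gcongr)
    _ = 1 / ((k ^ 2 : ℕ) : ℝ) * |∑ i ∈ Finset.range (k ^ 2), a i| + 2 * (1 / (k : ℝ)) := by
        push_cast
        field_simp

/-- If the second moments of a sequence are summable, the sequence tends to `0` almost surely. -/
lemma ae_tendsto_zero_of_summable_integral_sq {Ω : Type*} [MeasurableSpace Ω] {P : Measure Ω}
    {T : ℕ → Ω → ℝ} (hT : ∀ k, Measurable (T k)) (hint : ∀ k, Integrable (fun ω => T k ω ^ 2) P)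
    (hsum : Summable fun k => ∫ ω, T k ω ^ 2 ∂P) :
    ∀ᵐ ω ∂P, Tendsto (fun k => T k ω) atTop (nhds 0) := by
  have hlint : ∫⁻ ω, ∑' k, ENNReal.ofReal (T k ω ^ 2) ∂P ≠ ⊤ := by
    rw [lintegral_tsum fun k => ((hT k).pow_const 2).ennreal_ofReal.aemeasurable]
    simp_rw [← fun k => ofReal_integral_eq_lintegral_ofReal (hint k)
      (ae_of_all _ fun ω => sq_nonneg (T k ω))]
    exact hsum.tsum_ofReal_ne_top
  have hmeas : Measurable fun ω => ∑' k, ENNReal.ofReal (T k ω ^ 2) :=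
    Measurable.tsum fun k => ((hT k).pow_const 2).ennreal_ofReal
  filter_upwards [ae_lt_top hmeas hlint] with ω hω
  have h0 := (ENNReal.tendsto_toReal ENNReal.zero_ne_top).comp
    (ENNReal.tendsto_atTop_zero_of_tsum_ne_top hω.ne)
  have hsq : Tendsto (fun k => T k ω ^ 2) atTop (nhds 0) := by
    refine (h0.congr fun k => ?_)
    simp [ENNReal.toReal_ofReal (sq_nonneg (T k ω))]
  have habs := (Real.continuous_sqrt.tendsto 0).comp hsq
  rw [Real.sqrt_zero] at habs
  exact (tendsto_zero_iff_abs_tendsto_zero _).2 (habs.congr fun k => Real.sqrt_sq_eq_abs _)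

/-- The strong law of large numbers for bounded orthogonal random variables. -/
lemma ae_tendsto_average_of_orthogonal {Ω : Type*} [MeasurableSpace Ω] {P : Measure Ω}
    [IsProbabilityMeasure P] {D : ℕ → Ω → ℝ} (hD : ∀ i, Measurable (D i))
    (hbd : ∀ i ω, |D i ω| ≤ 1) (horth : ∀ i j, i < j → ∫ ω, D i ω * D j ω ∂P = 0) :
    ∀ᵐ ω ∂P, Tendsto (fun n : ℕ => (1 / (n : ℝ)) * ∑ i ∈ Finset.range n, D i ω)
      atTop (nhds 0) := by
  have hint : ∀ i j, Integrable (fun ω => D i ω * D j ω) P := fun i j =>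
    Integrable.of_bound ((hD i).mul (hD j)).aestronglyMeasurable 1
      (ae_of_all _ fun ω => by
        rw [Real.norm_eq_abs, abs_mul]
        exact mul_le_one₀ (hbd i ω) (abs_nonneg _) (hbd j ω))
  have hexpand : ∀ n : ℕ, (fun ω => (∑ i ∈ Finset.range n, D i ω) ^ 2) =
      fun ω => ∑ i ∈ Finset.range n, ∑ j ∈ Finset.range n, D i ω * D j ω := fun n => by
    ext ω
    rw [sq, Finset.sum_mul_sum]
  have hintsq : ∀ n : ℕ, Integrable (fun ω => (∑ i ∈ Finset.range n, D i ω) ^ 2) P := fun n => by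
    rw [hexpand]
    exact integrable_finsetSum _ fun i _ => integrable_finsetSum _ fun j _ => hint i j
  have hsq : ∀ n : ℕ, ∫ ω, (∑ i ∈ Finset.range n, D i ω) ^ 2 ∂P ≤ n := fun n => by
    rw [hexpand, integral_finsetSum _ fun i _ => integrable_finsetSum _ fun j _ => hint i j]
    calc ∑ i ∈ Finset.range n, ∫ ω, ∑ j ∈ Finset.range n, D i ω * D j ω ∂P
        ≤ ∑ i ∈ Finset.range n, (1 : ℝ) := by
          refine Finset.sum_le_sum fun i hi => ?_
          rw [integral_finsetSum _ fun j _ => hint i j, Finset.sum_eq_single_of_mem i hi]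
          · calc ∫ ω, D i ω * D i ω ∂P ≤ ∫ _, (1 : ℝ) ∂P :=
                  integral_mono (hint i i) (integrable_const 1) fun ω => by
                    have := abs_le.1 (hbd i ω)
                    change D i ω * D i ω ≤ 1
                    nlinarith
              _ = 1 := by simp
          · intro j _ hji
            rcases lt_or_gt_of_ne hji with h | h
            · simp_rw [mul_comm (D i _)]
              exact horth j i h
            · exact horth i j h
      _ = n := by simp
  have hsubseq := ae_tendsto_zero_of_summable_integral_sq (P := P)
    (T := fun k ω => (1 / ((k ^ 2 : ℕ) : ℝ)) * ∑ i ∈ Finset.range (k ^ 2), D i ω)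
    (fun k => (Finset.measurable_sum _ fun i _ => hD i).const_mul _)
    (fun k => by
      simp_rw [mul_pow]
      exact (hintsq (k ^ 2)).const_mul _)
    (by
      refine Summable.of_nonneg_of_le (fun k => integral_nonneg fun ω => sq_nonneg _) (fun k => ?_)
        (Real.summable_one_div_nat_pow.2 one_lt_two)
      simp_rw [mul_pow]
      rw [integral_const_mul]
      calc (1 / ((k ^ 2 : ℕ) : ℝ)) ^ 2 * ∫ ω, (∑ i ∈ Finset.range (k ^ 2), D i ω) ^ 2 ∂P
          ≤ (1 / ((k ^ 2 : ℕ) : ℝ)) ^ 2 * ((k ^ 2 : ℕ) : ℝ) := by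
            gcongr
            exact hsq _
        _ = 1 / (k : ℝ) ^ 2 := by
            rcases eq_or_ne k 0 with rfl | hk
            · simp
            · push_cast
              field_simp)
  filter_upwards [hsubseq] with ω hω
  exact tendsto_average_of_tendsto_average_sq (fun i => hbd i ω) hω

lemma measurable_sigmaGen_toReal {Ω S : Type*} [MeasurableSpace S]
    (ξ : ℕ → Ω → Measure S) {A : Set S} (hA : MeasurableSet A) (i : ℕ) :
    Measurable[sigmaGen ξ] fun ω => (ξ i ω A).toReal := by
  have hξ : Measurable[sigmaGen ξ] (ξ i) :=
    (comap_measurable (ξ i)).mono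
      (le_iSup (fun n => MeasurableSpace.comap (ξ n) inferInstance) i) le_rfl
  exact ((Measure.measurable_coe hA).comp hξ).ennreal_toReal

namespace IsProductDisintegration

variable {Ω S : Type*} [MeasurableSpace Ω] [MeasurableSpace S] {P : Measure Ω}
  {X : ℕ → Ω → S} {ξ : ℕ → Ω → Measure S}

lemma sigmaGen_le (h : IsProductDisintegration P X ξ) : sigmaGen ξ ≤ ‹MeasurableSpace Ω› :=
  iSup_le fun n => (h.2.1 n).comap_le

lemma condExp_indicator (h : IsProductDisintegration P X ξ) {A : Set S} (hA : MeasurableSet A)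
    (i : ℕ) :
    P[fun ω => A.indicator (fun _ => (1 : ℝ)) (X i ω) | sigmaGen ξ]
      =ᵐ[P] fun ω => (ξ i ω A).toReal := by
  have := h.2.2.1
  have key := h.2.2.2 i (fun l => if (l : ℕ) = i then A else Set.univ)
    fun l => by split_ifs <;> simp [hA]
  have h1 : ∀ F : ℕ → Set S → ℝ, (∀ l, F l Set.univ = 1) →
      ∏ l : Fin (i + 1), F l (if (l : ℕ) = i then A else Set.univ) = F i A := fun F hF => by
    rw [Fintype.prod_eq_single (Fin.last i)]
    · simp
    · intro l hl
      have hli : (l : ℕ) ≠ i := fun hli => hl (Fin.ext hli)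
      rw [if_neg hli, hF]
  have e1 := fun ω => h1 (fun l B => B.indicator (fun _ => (1 : ℝ)) (X l ω)) (by simp)
  have e2 := fun ω => h1 (fun l B => (ξ l ω B).toReal) (by simp)
  simpa only [e1, e2] using key

lemma condExp_indicator_mul_indicator (h : IsProductDisintegration P X ξ) {A : Set S}
    (hA : MeasurableSet A) {i j : ℕ} (hij : i < j) :
    P[fun ω => A.indicator (fun _ => (1 : ℝ)) (X i ω) * A.indicator (fun _ => (1 : ℝ)) (X j ω)
      | sigmaGen ξ] =ᵐ[P] fun ω => (ξ i ω A).toReal * (ξ j ω A).toReal := by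
  have := h.2.2.1
  have key := h.2.2.2 j (fun l => if (l : ℕ) = i ∨ (l : ℕ) = j then A else Set.univ)
    fun l => by split_ifs <;> simp [hA]
  have h1 : ∀ F : ℕ → Set S → ℝ, (∀ l, F l Set.univ = 1) →
      ∏ l : Fin (j + 1), F l (if (l : ℕ) = i ∨ (l : ℕ) = j then A else Set.univ)
        = F i A * F j A := fun F hF => by
    rw [Fintype.prod_eq_mul ⟨i, by omega⟩ (Fin.last j)]
    · simp
    · simpa [Fin.ext_iff] using hij.ne
    · rintro l ⟨hli, hlj⟩
      rw [if_neg, hF]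
      simpa [Fin.ext_iff] using And.intro hli hlj
  have e1 := fun ω => h1 (fun l B => B.indicator (fun _ => (1 : ℝ)) (X l ω)) (by simp)
  have e2 := fun ω => h1 (fun l B => (ξ l ω B).toReal) (by simp)
  simpa only [e1, e2] using key

lemma integral_centered_mul_centered [IsProbabilityMeasure P] (h : IsProductDisintegration P X ξ)
    {A : Set S} (hA : MeasurableSet A) {i j : ℕ} (hij : i < j) :
    ∫ ω, (A.indicator (fun _ => (1 : ℝ)) (X i ω) - (ξ i ω A).toReal) *
      (A.indicator (fun _ => (1 : ℝ)) (X j ω) - (ξ j ω A).toReal) ∂P = 0 := by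
  have := h.2.2.1
  have hm := h.sigmaGen_le
  set Y : ℕ → Ω → ℝ := fun i ω => A.indicator (fun _ => (1 : ℝ)) (X i ω) with hY
  set p : ℕ → Ω → ℝ := fun i ω => (ξ i ω A).toReal
  have hYm : ∀ i, Measurable (Y i) := fun i => (measurable_const.indicator hA).comp (h.1 i)
  have hpm' : ∀ i, Measurable[sigmaGen ξ] (p i) := measurable_sigmaGen_toReal ξ hA
  have hpm : ∀ i, Measurable (p i) := fun i => (hpm' i).mono hm le_rfl
  have hYb : ∀ i ω, ‖Y i ω‖ ≤ 1 := fun i ω => by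
    by_cases hx : X i ω ∈ A <;> simp [hY, hx]
  have hpb : ∀ i ω, ‖p i ω‖ ≤ 1 := fun i ω => by
    rw [Real.norm_of_nonneg ENNReal.toReal_nonneg]
    exact measureReal_le_one
  have hint : ∀ {u v : Ω → ℝ}, Measurable u → Measurable v → (∀ ω, ‖u ω‖ ≤ 1) →
      (∀ ω, ‖v ω‖ ≤ 1) → Integrable (fun ω => u ω * v ω) P := fun hu hv hub hvb =>
    Integrable.of_bound (hu.mul hv).aestronglyMeasurable 1 (ae_of_all _ fun ω => by
      rw [norm_mul]
      exact mul_le_one₀ (hub ω) (norm_nonneg _) (hvb ω))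
  have hYint : ∀ i, Integrable (Y i) P := fun i =>
    Integrable.of_bound (hYm i).aestronglyMeasurable 1 (ae_of_all _ (hYb i))
  have hYY : ∫ ω, Y i ω * Y j ω ∂P = ∫ ω, p i ω * p j ω ∂P := by
    rw [← integral_condExp hm]
    exact integral_congr_ae (h.condExp_indicator_mul_indicator hA hij)
  have hpY : ∀ k l, ∫ ω, p k ω * Y l ω ∂P = ∫ ω, p k ω * p l ω ∂P := fun k l => by
    rw [← integral_condExp hm]
    refine integral_congr_ae ?_
    refine (condExp_mul_of_stronglyMeasurable_left (hpm' k).stronglyMeasurable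
      (hint (hpm k) (hYm l) (hpb k) (hYb l)) (hYint l)).trans ?_
    filter_upwards [h.condExp_indicator hA l] with ω hω
    rw [Pi.mul_apply, hω]
  have hYp : ∫ ω, Y i ω * p j ω ∂P = ∫ ω, p i ω * p j ω ∂P := by
    simpa only [mul_comm] using hpY j i
  have hexpand : (fun ω => (Y i ω - p i ω) * (Y j ω - p j ω)) =
      fun ω => (Y i ω * Y j ω - Y i ω * p j ω) - (p i ω * Y j ω - p i ω * p j ω) := by
    ext ω
    ring
  have iYY := hint (hYm i) (hYm j) (hYb i) (hYb j)
  have iYp := hint (hYm i) (hpm j) (hYb i) (hpb j)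
  have ipY := hint (hpm i) (hYm j) (hpb i) (hYb j)
  have ipp := hint (hpm i) (hpm j) (hpb i) (hpb j)
  change ∫ ω, (Y i ω - p i ω) * (Y j ω - p j ω) ∂P = 0
  rw [hexpand]
  refine (integral_sub (iYY.sub iYp) (ipY.sub ipp)).trans ?_
  simp only [Pi.sub_apply]
  rw [integral_sub iYY iYp, integral_sub ipY ipp, hYY, hYp, hpY i j]
  ring

lemma ae_tendsto_average_indicator [IsProbabilityMeasure P] (h : IsProductDisintegration P X ξ)
    {A : Set S} (hA : MeasurableSet A) :
    ∀ᵐ ω ∂P, Tendsto (fun n : ℕ => (1 / (n : ℝ)) * ∑ i ∈ Finset.range n,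
      (A.indicator (fun _ => (1 : ℝ)) (X i ω) - (ξ i ω A).toReal)) atTop (nhds 0) := by
  have := h.2.2.1
  refine ae_tendsto_average_of_orthogonal
    (D := fun i ω => A.indicator (fun _ => (1 : ℝ)) (X i ω) - (ξ i ω A).toReal)
    (fun i => ((measurable_const.indicator hA).comp (h.1 i)).sub
      ((measurable_sigmaGen_toReal ξ hA i).mono h.sigmaGen_le le_rfl))
    (fun i ω => ?_) fun i j hij => h.integral_centered_mul_centered hA hij
  have h0 : 0 ≤ (ξ i ω A).toReal := ENNReal.toReal_nonneg
  have h1 : (ξ i ω A).toReal ≤ 1 := measureReal_le_one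
  by_cases hx : X i ω ∈ A <;> simp only [hx, Set.indicator_of_mem, Set.indicator_of_notMem,
    not_false_eq_true] <;> rw [abs_le] <;> constructor <;> linarith

lemma ae_tendsto_average_simpleFunc [IsProbabilityMeasure P] (h : IsProductDisintegration P X ξ)
    (g : SimpleFunc S ℝ) :
    ∀ᵐ ω ∂P, Tendsto (fun n : ℕ => (1 / (n : ℝ)) * ∑ i ∈ Finset.range n,
      (g (X i ω) - ∫ x, g x ∂(ξ i ω))) atTop (nhds 0) := by
  have := h.2.2.1
  induction g using SimpleFunc.induction with
  | @const c A hA =>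
    filter_upwards [h.ae_tendsto_average_indicator hA] with ω hω
    have hω' := hω.const_mul c
    rw [mul_zero] at hω'
    refine hω'.congr fun n => ?_
    rw [mul_left_comm, Finset.mul_sum]
    congr 1
    refine Finset.sum_congr rfl fun i _ => ?_
    have hI : ∫ x, (SimpleFunc.piecewise A hA (SimpleFunc.const S c) (SimpleFunc.const S 0)) x
        ∂(ξ i ω) = (ξ i ω).real A • c := by
      rw [← integral_indicator_const (μ := ξ i ω) c hA]
      refine integral_congr_ae (ae_of_all _ fun x => ?_)
      by_cases hx : x ∈ A <;> simp [hx]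
    rw [hI, smul_eq_mul, Measure.real]
    by_cases hx : X i ω ∈ A <;> simp [hx] <;> ring
  | @add g₁ g₂ _ hg₁ hg₂ =>
    filter_upwards [hg₁, hg₂] with ω hω₁ hω₂
    have hω := hω₁.add hω₂
    rw [add_zero] at hω
    refine hω.congr fun n => ?_
    rw [← mul_add, ← Finset.sum_add_distrib]
    congr 1
    refine Finset.sum_congr rfl fun i _ => ?_
    simp only [SimpleFunc.coe_add, Pi.add_apply]
    rw [integral_add (SimpleFunc.integrable_of_isFiniteMeasure g₁)
      (SimpleFunc.integrable_of_isFiniteMeasure g₂)]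
    ring

end IsProductDisintegration

/-- A bounded measurable real function is a uniform limit of simple functions. -/
lemma exists_simpleFunc_abs_sub_le {S : Type*} [MeasurableSpace S] {f : S → ℝ}
    (hf : Measurable f) {C : ℝ} (hC : ∀ x, |f x| ≤ C) {ε : ℝ} (hε : 0 < ε) :
    ∃ g : SimpleFunc S ℝ, ∀ x, |f x - g x| ≤ ε := by
  refine ⟨⟨fun x => ε * (⌊f x / ε⌋ : ℝ), fun y => ?_, ?_⟩, fun x => ?_⟩
  · have hm : Measurable fun x => ε * (⌊f x / ε⌋ : ℝ) :=
      ((measurable_from_top (f := fun z : ℤ => (z : ℝ))).comp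
        (hf.div_const ε).floor).const_mul ε
    exact hm (measurableSet_singleton y)
  · refine ((Set.finite_Icc ⌊-C / ε⌋ ⌊C / ε⌋).image fun z : ℤ => ε * (z : ℝ)).subset ?_
    rintro _ ⟨x, rfl⟩
    have := abs_le.1 (hC x)
    exact ⟨⌊f x / ε⌋, ⟨by gcongr; exact this.1, by gcongr; exact this.2⟩, rfl⟩
  · change |f x - ε * (⌊f x / ε⌋ : ℝ)| ≤ ε
    have h1 := Int.floor_le (f x / ε)
    have h2 := Int.lt_floor_add_one (f x / ε)
    rw [le_div_iff₀ hε] at h1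
    rw [div_lt_iff₀ hε] at h2
    rw [abs_le]
    constructor <;> nlinarith

/-- Cesàro averages of uniformly close sequences are uniformly close. -/
lemma abs_average_sub_average_le {a b : ℕ → ℝ} {ε : ℝ} (hε : 0 ≤ ε)
    (hab : ∀ i, |a i - b i| ≤ ε) (n : ℕ) :
    |(1 / (n : ℝ)) * ∑ i ∈ Finset.range n, a i - (1 / (n : ℝ)) * ∑ i ∈ Finset.range n, b i| ≤ ε := by
  rw [← mul_sub, ← Finset.sum_sub_distrib, abs_mul, abs_of_nonneg (by positivity)]
  calc 1 / (n : ℝ) * |∑ i ∈ Finset.range n, (a i - b i)|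
      ≤ 1 / (n : ℝ) * ∑ i ∈ Finset.range n, ε := by
        gcongr
        exact (Finset.abs_sum_le_sum_abs _ _).trans (Finset.sum_le_sum fun i _ => hab i)
    _ ≤ ε := by
        rcases eq_or_ne n 0 with rfl | hn
        · simpa using hε
        · have : (n : ℝ) ≠ 0 := by exact_mod_cast hn
          simp [this]

theorem statement0
    {Ω : Type*} [MeasurableSpace Ω] (P : Measure Ω) [IsProbabilityMeasure P]
    {S : Type*} [TopologicalSpace S] [CompactSpace S] [TopologicalSpace.MetrizableSpace S]
    [MeasurableSpace S] [BorelSpace S]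
    (X : ℕ → Ω → S) (ξ : ℕ → Ω → Measure S)
    (hdis : IsProductDisintegration P X ξ)
    (f : S → ℝ) (hf : Continuous f) :
    ∀ᵐ ω ∂P,
      Tendsto (fun n : ℕ =>
          (1 / (n : ℝ)) * ∑ i ∈ Finset.range n, (f (X i ω) - ∫ x, f x ∂(ξ i ω)))
        atTop (nhds 0) := by
  have := hdis.2.2.1
  obtain ⟨C, hC⟩ : ∃ C, ∀ x, |f x| ≤ C := by
    obtain ⟨C, hC⟩ := isCompact_univ.exists_bound_of_continuousOn hf.continuousOn
    exact ⟨C, fun x => hC x (Set.mem_univ x)⟩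
  have happrox : ∀ k : ℕ, ∃ g : SimpleFunc S ℝ, ∀ x, |f x - g x| ≤ 1 / ((k : ℝ) + 1) :=
    fun k => exists_simpleFunc_abs_sub_le hf.measurable hC Nat.one_div_pos_of_nat
  choose g hg using happrox
  have hg_ae := ae_all_iff.2 fun k => hdis.ae_tendsto_average_simpleFunc (g k)
  filter_upwards [hg_ae] with ω hω
  rw [Metric.tendsto_atTop]
  intro ε hε
  obtain ⟨k, hk⟩ := exists_nat_one_div_lt (show 0 < ε / 4 by positivity)
  obtain ⟨N, hN⟩ := Metric.tendsto_atTop.1 (hω k) (ε / 2) (by positivity)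
  refine ⟨N, fun n hn => ?_⟩
  have hclose : ∀ i, |(f (X i ω) - ∫ x, f x ∂(ξ i ω)) - (g k (X i ω) - ∫ x, g k x ∂(ξ i ω))|
      ≤ ε / 2 := fun i => by
    have hfint : Integrable f (ξ i ω) :=
      Integrable.of_bound hf.measurable.aestronglyMeasurable C (ae_of_all _ hC)
    have hI : |∫ x, f x ∂(ξ i ω) - ∫ x, g k x ∂(ξ i ω)| ≤ 1 / ((k : ℝ) + 1) := by
      rw [← integral_sub hfint (SimpleFunc.integrable_of_isFiniteMeasure (g k))]
      simpa using norm_integral_le_of_norm_le_const (μ := ξ i ω)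
        (f := fun x => f x - g k x) (ae_of_all _ (hg k))
    have h1 := abs_le.1 (hg k (X i ω))
    have h2 := abs_le.1 hI
    rw [abs_le]
    constructor <;> linarith
  have h1 := abs_le.1 (abs_average_sub_average_le (by positivity) hclose n)
  have h2 := hN n hn
  rw [Real.dist_eq, sub_zero, abs_lt] at h2 ⊢
  constructor <;> linarith
end
end

section
/- Let X = (X₀, X₁, …) be a sequence of S-valued random variables, ξ = (ξ₀, ξ₁, …) a product disintegration of X, and f : S → ℝ continuous. Then the limit X_∞(f) := limₙ→∞ (1/n) ∑_{i=0}^{n-1} f(Xᵢ) exists almost surely if and only if the limit ξ_∞(f) := limₙ→∞ (1/n) ∑_{i=0}^{n-1} ξᵢ(f) exists almost surely, and in that case X_∞(f) = ξ_∞(f) almost surely, where ξᵢ(f) denotes the random variable ω ↦ ∫_S f dξᵢ(ω). -/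
open MeasureTheory ProbabilityTheory Filter

noncomputable section

theorem tendsto_average_zero_of_uncorrelated {Ω : Type*} [MeasurableSpace Ω] {P : Measure Ω}
    [IsProbabilityMeasure P] {Y : ℕ → Ω → ℝ} {C : ℝ} (hY : ∀ i, Measurable (Y i))
    (hC : ∀ i ω, |Y i ω| ≤ C) (horth : ∀ i j, i ≠ j → ∫ ω, Y i ω * Y j ω ∂P = 0) :
    ∀ᵐ ω ∂P, Tendsto (fun n : ℕ => (1 / (n : ℝ)) * ∑ i ∈ Finset.range n, Y i ω)
      atTop (nhds 0) := by
  have hint (i j) : Integrable (fun ω => Y i ω * Y j ω) P := by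
    refine Integrable.of_bound ((hY i).mul (hY j)).aestronglyMeasurable (C * C) (.of_forall fun ω => ?_)
    rw [norm_mul]
    exact mul_le_mul (hC i ω) (hC j ω) (norm_nonneg _) ((abs_nonneg _).trans (hC i ω))
  have hsq (n : ℕ) : ∫ ω, (∑ i ∈ Finset.range n, Y i ω) ^ 2 ∂P ≤ n * C ^ 2 := by
    simp_rw [sq, Finset.sum_mul_sum]
    rw [integral_finsetSum _ fun i _ => integrable_finsetSum _ fun j _ => hint i j]
    calc _ ≤ ∑ i ∈ Finset.range n, C * C := by
          refine Finset.sum_le_sum fun i hi => ?_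
          rw [integral_finsetSum _ fun j _ => hint i j,
            Finset.sum_eq_single_of_mem i hi fun j _ hj => horth i j hj.symm]
          calc _ ≤ ∫ ω, C * C ∂P := by
                refine integral_mono (hint i i) (integrable_const _) fun ω => ?_
                exact (abs_mul_abs_self _).symm.trans_le
                  (mul_self_le_mul_self (abs_nonneg _) (hC i ω))
            _ = _ := by simp
      _ = _ := by simp
  have hmeas (n : ℕ) : Measurable fun ω => ∑ i ∈ Finset.range n, Y i ω :=
    Finset.measurable_fun_sum _ fun i _ => hY i
  have hsqint (n : ℕ) : Integrable (fun ω => (∑ i ∈ Finset.range n, Y i ω) ^ 2) P := by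
    simp_rw [sq, Finset.sum_mul_sum]
    exact integrable_finsetSum _ fun i _ => integrable_finsetSum _ fun j _ => hint i j
  set Z : ℕ → Ω → ℝ := fun k ω =>
    ((∑ i ∈ Finset.range ((k + 1) ^ 2), Y i ω) / ((k + 1 : ℕ) ^ 2 : ℕ)) ^ 2 with hZ
  have hZm (k) : Measurable (Z k) := ((hmeas _).div_const _).pow_const 2
  have hZint (k : ℕ) : ∫⁻ ω, ENNReal.ofReal (Z k ω) ∂P ≤
      ENNReal.ofReal (C ^ 2 * (1 / ((k + 1 : ℕ) : ℝ) ^ 2)) := by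
    rw [← ofReal_integral_eq_lintegral_ofReal]
    · refine ENNReal.ofReal_le_ofReal ?_
      simp_rw [hZ, div_pow]
      rw [integral_div, div_le_iff₀ (by positivity)]
      refine (hsq _).trans (le_of_eq ?_)
      push_cast
      field_simp
    · simp_rw [hZ, div_pow]
      exact (hsqint _).div_const _
    · exact .of_forall fun ω => sq_nonneg _
  have hsum : Summable fun k : ℕ => C ^ 2 * (1 / ((k + 1 : ℕ) : ℝ) ^ 2) :=
    ((summable_nat_add_iff 1).2 (Real.summable_one_div_nat_pow.2 one_lt_two)).mul_left _
  have hfin : ∫⁻ ω, ∑' k, ENNReal.ofReal (Z k ω) ∂P ≠ ⊤ := by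
    rw [lintegral_tsum fun k => (hZm k).ennreal_ofReal.aemeasurable]
    refine ne_top_of_le_ne_top ?_ (ENNReal.tsum_le_tsum hZint)
    exact hsum.tsum_ofReal_ne_top
  filter_upwards [ae_lt_top (Measurable.tsum fun k => (hZm k).ennreal_ofReal) hfin] with ω hω
  have hZ0 : Tendsto (fun k => Z k ω) atTop (nhds 0) := by
    have := ENNReal.tendsto_atTop_zero_of_tsum_ne_top hω.ne
    have := (ENNReal.tendsto_toReal ENNReal.zero_ne_top).comp this
    refine this.congr fun k => ?_
    exact ENNReal.toReal_ofReal (sq_nonneg _)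
  have hsub : Tendsto (fun k : ℕ => (∑ i ∈ Finset.range ((k + 1) ^ 2), Y i ω) /
      ((k + 1 : ℕ) ^ 2 : ℕ)) atTop (nhds 0) := by
    have := hZ0.sqrt
    simp only [hZ, Real.sqrt_sq_eq_abs, Real.sqrt_zero] at this
    exact (tendsto_zero_iff_abs_tendsto_zero _).2 this
  have key := tendsto_div_of_monotone_of_exists_subseq_tendsto_div
    (fun n => ∑ i ∈ Finset.range n, (Y i ω + C)) C
    (monotone_nat_of_le_succ fun n => by
      rw [Finset.sum_range_succ]
      linarith [neg_le_of_abs_le (hC n ω)])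
    (fun a ha => by
      refine ⟨fun k => (k + 1) ^ 2, ?_, ?_, ?_⟩
      · have h1 : Tendsto (fun k : ℕ => (((k + 1 : ℕ) : ℝ) + 1) / ((k + 1 : ℕ) : ℝ)) atTop (nhds 1) := by
          have := (tendsto_one_div_add_atTop_nhds_zero_nat (𝕜 := ℝ)).const_add 1
          rw [add_zero] at this
          refine this.congr fun k => ?_
          push_cast
          field_simp
        have h2 := h1.pow 2
        rw [one_pow] at h2
        filter_upwards [h2.eventually_le_const ha] with k hk
        rw [div_pow, div_le_iff₀ (by positivity)] at hk
        push_cast at hk ⊢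
        exact hk
      · exact (tendsto_pow_atTop two_ne_zero).comp (tendsto_add_atTop_nat 1)
      · have := hsub.add_const C
        rw [zero_add] at this
        refine this.congr fun k => ?_
        rw [Finset.sum_add_distrib]
        simp only [Finset.sum_const, Finset.card_range, nsmul_eq_mul]
        push_cast
        field_simp)
  have := key.sub_const C
  rw [sub_self] at this
  refine this.congr' ?_
  filter_upwards [eventually_gt_atTop 0] with n hn
  rw [Finset.sum_add_distrib]
  simp only [Finset.sum_const, Finset.card_range, nsmul_eq_mul]
  field_simp
  ring

theorem integral_centered_mul_eq_zero {Ω Ω' S : Type*} [MeasurableSpace Ω] [MeasurableSpace Ω']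
    [MeasurableSpace S] {P : Measure Ω} [IsProbabilityMeasure P] {T : Ω → Ω'} (hT : Measurable T)
    (κ η : Kernel Ω' S) [IsMarkovKernel κ] [IsMarkovKernel η] {X Y : Ω → S}
    (hX : Measurable X) (hY : Measurable Y)
    (h : ∀ B A A', MeasurableSet B → MeasurableSet A → MeasurableSet A' →
      P (T ⁻¹' B ∩ (X ⁻¹' A ∩ Y ⁻¹' A')) = ∫⁻ ω in T ⁻¹' B, κ (T ω) A * η (T ω) A' ∂P)
    {f : S → ℝ} (hf : Measurable f) {C : ℝ} (hC : ∀ x, |f x| ≤ C) :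
    ∫ ω, (f (X ω) - ∫ x, f x ∂κ (T ω)) * (f (Y ω) - ∫ x, f x ∂η (T ω)) ∂P = 0 := by
  have : IsProbabilityMeasure (P.map T) := Measure.isProbabilityMeasure_map hT.aemeasurable
  have hlaw : P.map (fun ω => (T ω, X ω, Y ω)) = P.map T ⊗ₘ (κ ×ₖ η) := by
    have : IsProbabilityMeasure (P.map (fun ω => (T ω, X ω, Y ω))) :=
      Measure.isProbabilityMeasure_map (by fun_prop)
    refine Measure.ext_prod₃ fun {B A A'} hB hA hA' => ?_
    rw [Measure.map_apply (by fun_prop) (hB.prod (hA.prod hA')),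
      Measure.compProd_apply_prod hB (hA.prod hA')]
    simp_rw [Kernel.prod_apply_prod]
    rw [setLIntegral_map hB (f := fun t => κ t A * η t A')
      ((κ.measurable_coe hA).mul (η.measurable_coe hA')) hT]
    exact h B A A' hB hA hA'
  have hint (μ : Measure S) [IsProbabilityMeasure μ] : Integrable f μ :=
    Integrable.of_bound hf.aestronglyMeasurable C (.of_forall hC)
  have hbd (μ : Measure S) [IsProbabilityMeasure μ] (x : S) : |f x - ∫ y, f y ∂μ| ≤ C + C := by
    refine (abs_sub _ _).trans (add_le_add (hC x) ?_)
    simpa using norm_integral_le_of_norm_le_const (μ := μ) (f := f) (.of_forall hC)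
  have hκ (κ : Kernel Ω' S) [IsMarkovKernel κ] : Measurable fun t => ∫ x, f x ∂κ t :=
    (hf.stronglyMeasurable.integral_kernel (κ := κ)).measurable
  set g : Ω' × S × S → ℝ := fun z =>
    (f z.2.1 - ∫ x, f x ∂κ z.1) * (f z.2.2 - ∫ x, f x ∂η z.1) with hg
  have hgm : Measurable g :=
    ((hf.comp (by fun_prop)).sub ((hκ κ).comp (by fun_prop))).mul
      ((hf.comp (by fun_prop)).sub ((hκ η).comp (by fun_prop)))
  have hgint : Integrable g (P.map T ⊗ₘ (κ ×ₖ η)) := by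
    refine Integrable.of_bound hgm.aestronglyMeasurable ((C + C) * (C + C)) (.of_forall fun z => ?_)
    rw [norm_mul]
    exact mul_le_mul (hbd _ _) (hbd _ _) (norm_nonneg _) ((abs_nonneg _).trans (hbd (κ z.1) z.2.1))
  calc _ = ∫ z, g z ∂P.map (fun ω => (T ω, X ω, Y ω)) :=
        (integral_map (by fun_prop) hgm.aestronglyMeasurable).symm
    _ = ∫ t, ∫ z, g (t, z) ∂(κ ×ₖ η) t ∂P.map T := by rw [hlaw, Measure.integral_compProd hgint]
    _ = 0 := by
      refine integral_eq_zero_of_ae (.of_forall fun t => ?_)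
      simp only [hg, Kernel.prod_apply, Pi.zero_apply]
      rw [integral_prod_mul (fun x => f x - ∫ x, f x ∂κ t) (fun y => f y - ∫ x, f x ∂η t),
        integral_sub (hint _) (integrable_const _)]
      simp

theorem IsProductDisintegration.sigmaGen_le_s1 {Ω S : Type*} [mΩ : MeasurableSpace Ω]
    [MeasurableSpace S] {P : Measure Ω} {X : ℕ → Ω → S} {ξ : ℕ → Ω → Measure S}
    (h : IsProductDisintegration P X ξ) : sigmaGen ξ ≤ mΩ :=
  iSup_le fun n => (h.2.1 n).comap_le

theorem measurable_sigmaGen {Ω S : Type*} [MeasurableSpace S] (ξ : ℕ → Ω → Measure S) (n : ℕ) :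
    Measurable[sigmaGen ξ] (ξ n) :=
  Measurable.mono (comap_measurable (ξ n)) (le_iSup (fun n => MeasurableSpace.comap (ξ n) _) n)
    le_rfl

theorem IsProductDisintegration.measure_inter {Ω S : Type*} [mΩ : MeasurableSpace Ω]
    [MeasurableSpace S] {P : Measure Ω} [IsProbabilityMeasure P] {X : ℕ → Ω → S}
    {ξ : ℕ → Ω → Measure S} (h : IsProductDisintegration P X ξ) {i j : ℕ} (hij : i ≠ j)
    {B : Set Ω} (hB : MeasurableSet[sigmaGen ξ] B) {A A' : Set S} (hA : MeasurableSet A)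
    (hA' : MeasurableSet A') :
    P (B ∩ (X i ⁻¹' A ∩ X j ⁻¹' A')) = ∫⁻ ω in B, ξ i ω A * ξ j ω A' ∂P := by
  obtain ⟨hX, hξ, hprob, hcond⟩ := id h
  have hBm := h.sigmaGen_le_s1 B hB
  let a : Fin (max i j + 1) := ⟨i, by omega⟩
  let b : Fin (max i j + 1) := ⟨j, by omega⟩
  have hab : a ≠ b := fun e => hij (congrArg Fin.val e)
  have hD := hcond (max i j) (fun k => if k = a then A else if k = b then A' else Set.univ)
    fun k => by split_ifs <;> simp [*]
  have hL : (fun ω => ∏ k : Fin (max i j + 1),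
      (if k = a then A else if k = b then A' else Set.univ).indicator (fun _ => (1 : ℝ)) (X k ω)) =
      (X i ⁻¹' A ∩ X j ⁻¹' A').indicator 1 := by
    ext ω
    rw [Fintype.prod_eq_mul a b hab fun k hk => by simp [hk.1, hk.2]]
    simp only [if_true, if_neg hab.symm, Set.inter_indicator_one, Pi.mul_apply]
    rfl
  have hR : (fun ω => ∏ k : Fin (max i j + 1),
      (ξ k ω (if k = a then A else if k = b then A' else Set.univ)).toReal) =
      fun ω => (ξ i ω A * ξ j ω A').toReal := by
    ext ω
    rw [Fintype.prod_eq_mul a b hab fun k hk => by simp [hk.1, hk.2, (hprob k ω).measure_univ]]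
    simp only [if_true, if_neg hab.symm, ENNReal.toReal_mul]
    rfl
  rw [hL, hR] at hD
  have hE : MeasurableSet (X i ⁻¹' A ∩ X j ⁻¹' A') := (hX i hA).inter (hX j hA')
  have key := setIntegral_condExp h.sigmaGen_le_s1
    (f := (X i ⁻¹' A ∩ X j ⁻¹' A').indicator (1 : Ω → ℝ)) (μ := P)
    ((integrable_const 1).indicator hE) hB
  have hle (ω) : ξ i ω A * ξ j ω A' ≤ 1 := by
    have := hprob i ω
    have := hprob j ω
    exact mul_le_one' prob_le_one prob_le_one
  rw [setIntegral_congr_ae hBm (hD.mono fun ω h _ => h), integral_indicator_one hE,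
    integral_toReal, Measure.real, Measure.restrict_apply hE, ENNReal.toReal_eq_toReal_iff'] at key
  · rw [key, Set.inter_comm]
  · refine ne_top_of_le_ne_top ENNReal.one_ne_top ?_
    exact (setLIntegral_mono measurable_const fun ω _ => hle ω).trans (by simp [prob_le_one])
  · exact measure_ne_top _ _
  · exact (((Measure.measurable_coe hA).comp (hξ i)).mul
      ((Measure.measurable_coe hA').comp (hξ j))).aemeasurable
  · exact .of_forall fun ω => (hle ω).trans_lt ENNReal.one_lt_top

theorem IsProductDisintegration.integral_centered_mul_eq_zero {Ω S : Type*} [mΩ : MeasurableSpace Ω]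
    [MeasurableSpace S] {P : Measure Ω} [IsProbabilityMeasure P] {X : ℕ → Ω → S}
    {ξ : ℕ → Ω → Measure S} (h : IsProductDisintegration P X ξ) {i j : ℕ} (hij : i ≠ j)
    {f : S → ℝ} (hf : Measurable f) {C : ℝ} (hC : ∀ x, |f x| ≤ C) :
    ∫ ω, (f (X i ω) - ∫ x, f x ∂ξ i ω) * (f (X j ω) - ∫ x, f x ∂ξ j ω) ∂P = 0 := by
  let κ (n : ℕ) : @Kernel Ω S (sigmaGen ξ) _ :=
    @Kernel.mk Ω S (sigmaGen ξ) _ (ξ n) (measurable_sigmaGen ξ n)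
  have hκ (n : ℕ) : @IsMarkovKernel Ω S (sigmaGen ξ) _ (κ n) :=
    @IsMarkovKernel.mk Ω S (sigmaGen ξ) _ (κ n) (h.2.2.1 n)
  exact @_root_.integral_centered_mul_eq_zero Ω Ω S mΩ (sigmaGen ξ) _ P _ id
    (measurable_id'' h.sigmaGen_le_s1) (κ i) (κ j) (hκ i) (hκ j) (X i) (X j) (h.1 i) (h.1 j)
    (fun B A A' hB hA hA' => h.measure_inter hij hB hA hA') f hf C hC

theorem IsProductDisintegration.tendsto_average_sub {Ω S : Type*} [MeasurableSpace Ω]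
    [MeasurableSpace S] {P : Measure Ω} [IsProbabilityMeasure P] {X : ℕ → Ω → S}
    {ξ : ℕ → Ω → Measure S} (h : IsProductDisintegration P X ξ)
    {f : S → ℝ} (hf : Measurable f) {C : ℝ} (hC : ∀ x, |f x| ≤ C) :
    ∀ᵐ ω ∂P, Tendsto (fun n : ℕ => (1 / (n : ℝ)) * ∑ i ∈ Finset.range n, f (X i ω) -
      (1 / (n : ℝ)) * ∑ i ∈ Finset.range n, ∫ x, f x ∂(ξ i ω)) atTop (nhds 0) := by
  have hprob := h.2.2.1
  have hmeas (i : ℕ) : Measurable fun ω => f (X i ω) - ∫ x, f x ∂ξ i ω := by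
    let κ : Kernel Ω S := ⟨ξ i, h.2.1 i⟩
    have : IsMarkovKernel κ := ⟨hprob i⟩
    exact (hf.comp (h.1 i)).sub (hf.stronglyMeasurable.integral_kernel (κ := κ)).measurable
  have hbd (i : ℕ) (ω : Ω) : |f (X i ω) - ∫ x, f x ∂ξ i ω| ≤ C + C := by
    refine (abs_sub _ _).trans (add_le_add (hC _) ?_)
    simpa using norm_integral_le_of_norm_le_const (μ := ξ i ω) (f := f) (.of_forall hC)
  filter_upwards [tendsto_average_zero_of_uncorrelated hmeas hbd fun i j hij =>
    h.integral_centered_mul_eq_zero hij hf hC] with ω hω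
  simpa only [Finset.sum_sub_distrib, mul_sub] using hω

theorem statement1
    {Ω : Type*} [MeasurableSpace Ω] (P : Measure Ω) [IsProbabilityMeasure P]
    {S : Type*} [TopologicalSpace S] [CompactSpace S] [TopologicalSpace.MetrizableSpace S]
    [MeasurableSpace S] [BorelSpace S]
    (X : ℕ → Ω → S) (ξ : ℕ → Ω → Measure S)
    (hdis : IsProductDisintegration P X ξ)
    (f : S → ℝ) (hf : Continuous f) :
    ((∀ᵐ ω ∂P, ∃ L : ℝ,
        Tendsto (fun n : ℕ => (1 / (n : ℝ)) * ∑ i ∈ Finset.range n, f (X i ω))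
          atTop (nhds L)) ↔
      (∀ᵐ ω ∂P, ∃ L : ℝ,
        Tendsto (fun n : ℕ => (1 / (n : ℝ)) * ∑ i ∈ Finset.range n, ∫ x, f x ∂(ξ i ω))
          atTop (nhds L))) ∧
    ∀ᵐ ω ∂P, ∀ LX Lξ : ℝ,
      Tendsto (fun n : ℕ => (1 / (n : ℝ)) * ∑ i ∈ Finset.range n, f (X i ω))
          atTop (nhds LX) →
      Tendsto (fun n : ℕ => (1 / (n : ℝ)) * ∑ i ∈ Finset.range n, ∫ x, f x ∂(ξ i ω))
          atTop (nhds Lξ) →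
      LX = Lξ := by
  obtain ⟨C, hC⟩ := isCompact_univ.exists_bound_of_continuousOn hf.continuousOn
  have hsub := hdis.tendsto_average_sub hf.measurable fun x => hC x (Set.mem_univ x)
  refine ⟨⟨fun h => ?_, fun h => ?_⟩, ?_⟩
  · filter_upwards [h, hsub] with ω ⟨L, hL⟩ hω
    exact ⟨L, by simpa using hL.sub hω⟩
  · filter_upwards [h, hsub] with ω ⟨L, hL⟩ hω
    exact ⟨L, by simpa using hL.add hω⟩
  · filter_upwards [hsub] with ω hω LX Lξ hX hξ
    exact sub_eq_zero.1 (tendsto_nhds_unique (hX.sub hξ) hω)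
end
end
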